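/- arXiv:1110.2841 — 2 statements merged into one kernel-verified Lean document; each statement's English description precedes it below -/
import Mathlib

section
/- Let G be a finite simple graph on n vertices. Then pd(G) ≥ n − i(G). -/
open CategoryTheory
open scoped ENNReal

noncomputable def projDim (R : Type) [CommRing R] (M : ModuleCat R) : ℕ∞ :=
  sSup {n : ℕ∞ | ∃ (i : ℕ) (N : ModuleCat R), n = i ∧
    Nontrivial (((Ext R (ModuleCat R) i).obj (Opposite.op M)).obj N)}

noncomputable def edgeIdeal (K : Type) [Field K] {V : Type} (G : SimpleGraph V) :
    Ideal (MvPolynomial V K) :=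
  Ideal.span {m | ∃ u v, G.Adj u v ∧ m = MvPolynomial.X u * MvPolynomial.X v}

noncomputable def graphPd (K : Type) [Field K] {V : Type} (G : SimpleGraph V) : ℕ∞ :=
  projDim (MvPolynomial V K)
    (ModuleCat.of (MvPolynomial V K) (MvPolynomial V K ⧸ edgeIdeal K G))

/-- `A` is a dominating set: every vertex outside `A` has a neighbor in `A`. -/
def IsDominatingSet {V : Type} (G : SimpleGraph V) (A : Set V) : Prop :=
  ∀ v ∉ A, ∃ a ∈ A, G.Adj v a

/-- A set of vertices is independent if no two of its vertices are adjacent. -/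
def IsIndepSet {V : Type} (G : SimpleGraph V) (A : Set V) : Prop :=
  ∀ u ∈ A, ∀ v ∈ A, ¬ G.Adj u v

/-- `γ(G)`: the minimum size of a dominating set. -/
noncomputable def domNum {V : Type} (G : SimpleGraph V) : ℕ :=
  sInf {n | ∃ A : Set V, IsDominatingSet G A ∧ A.ncard = n}

/-- `i(G)`: the minimum size of an independent dominating set. -/
noncomputable def indDomNum {V : Type} (G : SimpleGraph V) : ℕ :=
  sInf {n | ∃ A : Set V, IsDominatingSet G A ∧ IsIndepSet G A ∧ A.ncard = n}

/-- `γ₀(X, G)`: the minimum size of a set `A` with `X ⊆ N(A)`. -/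
noncomputable def gamma0Of {V : Type} (G : SimpleGraph V) (X : Set V) : ℕ :=
  sInf {n | ∃ A : Set V, (∀ x ∈ X, ∃ a ∈ A, G.Adj x a) ∧ A.ncard = n}

/-- `γ₀(G) = γ₀(V(G), G)`. -/
noncomputable def gamma0 {V : Type} (G : SimpleGraph V) : ℕ :=
  gamma0Of G Set.univ

/-- `τ(G)`: the maximum of `γ₀(A, G)` over independent sets `A`. -/
noncomputable def tauNum {V : Type} (G : SimpleGraph V) : ℕ :=
  sSup {n | ∃ A : Set V, IsIndepSet G A ∧ gamma0Of G A = n}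

/-- A set `F` of edges of `G` is edgewise dominant if every vertex of `G` is adjacent
to an endpoint of some edge in `F`. -/
def IsEdgewiseDominant {V : Type} (G : SimpleGraph V) (F : Set (Sym2 V)) : Prop :=
  F ⊆ G.edgeSet ∧ ∀ v : V, ∃ e ∈ F, ∃ w, w ∈ e ∧ G.Adj v w

/-- `ε(G)`: the minimum size of an edgewise dominant set of edges. -/
noncomputable def epsilonNum {V : Type} (G : SimpleGraph V) : ℕ :=
  sInf {n | ∃ F : Set (Sym2 V), IsEdgewiseDominant G F ∧ F.ncard = n}

/-- Positive-degree `Ext` in the sense of the derived category is controlled by `Ext` in the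
sense of derived functors. -/
lemma nontrivial_Ext_of_nontrivial_abelianExt {R : Type} [CommRing R] {M N : ModuleCat.{0} R}
    {n : ℕ} (h : Nontrivial (Abelian.Ext M N (n + 1))) :
    Nontrivial (((_root_.Ext R (ModuleCat.{0} R) (n + 1)).obj (Opposite.op M)).obj N) := by
  by_contra hsub
  rw [not_nontrivial_iff_subsingleton] at hsub
  obtain ⟨P⟩ := HasProjectiveResolution.out (Z := M)
  have hz := (ModuleCat.isZero_of_subsingleton _).of_iso (P.isoExt (R := R) (n + 1) N).symm
  rw [← HomologicalComplex.exactAt_iff_isZero_homology,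
    HomologicalComplex.exactAt_iff' _ n (n + 1) (n + 2) (by simp) (by simp),
    ShortComplex.moduleCat_exact_iff] at hz
  refine not_nontrivial_iff_subsingleton.mpr (subsingleton_of_forall_eq 0 fun α ↦ ?_) h
  obtain ⟨f, hf, rfl⟩ := P.extMk_surjective α (n + 2) rfl
  rw [P.extMk_eq_zero_iff f _ rfl hf n rfl]
  exact hz f hf

namespace CategoryTheory.Abelian.Ext

variable {R : Type} [CommRing R] {M M' N : ModuleCat.{0} R} {n : ℕ}

lemma mk₀_smul_id_comp (r : R) (x : Ext M N n) :
    (mk₀ (r • 𝟙 M)).comp x (zero_add n) = r • x := by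
  rw [mk₀_smul, smul_comp, mk₀_id_comp]

lemma smul_eq_zero_of_left {r : R} (h : ∀ m : M, r • m = 0) (x : Ext M N n) : r • x = 0 := by
  have : r • 𝟙 M = 0 := by ext m; exact h m
  rw [← mk₀_smul_id_comp, this, mk₀_zero, zero_comp]

lemma smul_eq_zero_of_right {r : R} (h : ∀ y : N, r • y = 0) (x : Ext M N n) : r • x = 0 := by
  have : r • 𝟙 N = 0 := by ext m; exact h m
  rw [smul_eq_comp_mk₀, this, mk₀_zero, comp_zero]

/-- Dividing by an `M`-regular element that annihilates `N` raises the degree of a nonzero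
`Ext` by one. -/
lemma nontrivial_succ_of_isSMulRegular {r : R} (g : M ⟶ M') (hr : IsSMulRegular M r)
    (hg : Function.Surjective g) (hker : ∀ m, g m = 0 ↔ ∃ m', r • m' = m)
    (hN : ∀ y : N, r • y = 0) (h : Nontrivial (Ext M N n)) :
    Nontrivial (Ext M' N (n + 1)) := by
  let S : ShortComplex (ModuleCat.{0} R) := ShortComplex.mk (r • 𝟙 M) g (by
    ext m; exact (hker _).mpr ⟨m, rfl⟩)
  have hS : S.ShortExact := ModuleCat.shortComplex_shortExact S
    (fun m ↦ hker m) hr hg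
  obtain ⟨x, hx⟩ := exists_ne (0 : Ext M N n)
  refine nontrivial_of_ne (hS.extClass.comp x (add_comm 1 n)) 0 fun h0 ↦ hx ?_
  obtain ⟨y, hy⟩ := contravariant_sequence_exact₁ hS N x (add_comm 1 n) h0
  rw [← hy]
  exact (mk₀_smul_id_comp r y).trans (smul_eq_zero_of_right hN y)

/-- If `g : M ⟶ M'` is surjective and its kernel is killed by an element acting as the identity
on `N`, then `Ext M' N` embeds in `Ext M N`. -/
lemma nontrivial_of_surjective {r : R} (g : M ⟶ M') (hg : Function.Surjective g)
    (hker : ∀ m, g m = 0 → r • m = 0) (hN : ∀ y : N, r • y = y)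
    (h : Nontrivial (Ext M' N (n + 1))) : Nontrivial (Ext M N (n + 1)) := by
  have hS := LinearMap.shortExact_shortComplexKer (f := g.hom) hg
  obtain ⟨x, hx⟩ := exists_ne (0 : Ext M' N (n + 1))
  refine nontrivial_of_ne ((mk₀ g).comp x (zero_add _)) 0 fun h0 ↦ hx ?_
  obtain ⟨y, hy⟩ := contravariant_sequence_exact₃ hS N x h0 (add_comm 1 n)
  have h1 : r • y = y := by
    have : r • 𝟙 N = 𝟙 N := by ext m; exact hN m
    rw [smul_eq_comp_mk₀, this, comp_mk₀_id]
  have h2 : r • y = 0 := smul_eq_zero_of_left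
    (fun m : LinearMap.ker g.hom ↦ Subtype.ext (hker m.1 m.2)) y
  rw [← hy, ← h1, h2, comp_zero]

end CategoryTheory.Abelian.Ext

namespace MvPolynomial

variable {K : Type} [Field K] {V : Type}

lemma mul_X_mem_span_X_image {s : Set V} {a : V} (ha : a ∉ s) {p : MvPolynomial V K}
    (h : X a * p ∈ Ideal.span (X '' s : Set (MvPolynomial V K))) :
    p ∈ Ideal.span (X '' s : Set (MvPolynomial V K)) := by
  classical
  rw [mem_ideal_span_X_image] at h ⊢
  intro m hm
  obtain ⟨i, hi, hmi⟩ := h (Finsupp.single a 1 + m) (by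
    rw [mem_support_iff, coeff_X_mul]; exact mem_support_iff.mp hm)
  refine ⟨i, hi, ?_⟩
  have hne : a ≠ i := fun h ↦ ha (h ▸ hi)
  simpa [Finsupp.single_eq_of_ne, hne, hne.symm] using hmi

lemma nontrivial_ext_quotient_span_X (N : ModuleCat.{0} (MvPolynomial V K)) [Nontrivial N]
    (s : Finset V) (hN : ∀ v ∈ s, ∀ y : N, (X v : MvPolynomial V K) • y = 0) :
    Nontrivial (Abelian.Ext (ModuleCat.of (MvPolynomial V K)
      (MvPolynomial V K ⧸ Ideal.span (X '' (s : Set V) : Set (MvPolynomial V K)))) N s.card) := by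
  classical
  induction s using Finset.induction_on with
  | empty =>
    rw [Finset.card_empty, Abelian.Ext.addEquiv₀.toEquiv.nontrivial_congr]
    obtain ⟨y, hy⟩ := exists_ne (0 : N)
    have hI : Ideal.span (X '' ((∅ : Finset V) : Set V) : Set (MvPolynomial V K)) = ⊥ := by simp
    refine nontrivial_of_ne (ModuleCat.ofHom (Submodule.liftQ _
      (LinearMap.toSpanSingleton (MvPolynomial V K) N y) (by rw [hI]; exact bot_le))) 0
      fun h0 ↦ hy ?_
    have := LinearMap.congr_fun (congrArg ModuleCat.Hom.hom h0) (Submodule.Quotient.mk 1)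
    exact (one_smul (MvPolynomial V K) y).symm.trans this
  | insert a s ha ih =>
    rw [Finset.card_insert_of_notMem ha]
    have hle : Ideal.span (X '' (s : Set V) : Set (MvPolynomial V K)) ≤
        Ideal.span (X '' ((insert a s : Finset V) : Set V)) :=
      Ideal.span_mono (Set.image_mono (by simp))
    refine Abelian.Ext.nontrivial_succ_of_isSMulRegular (r := X a)
      (ModuleCat.ofHom (Submodule.factor hle)) ?_ (Submodule.factor_surjective hle) ?_
      (hN a (by simp)) (ih fun v hv ↦ hN v (by simp [hv]))
    · refine isSMulRegular_iff_right_eq_zero_of_smul.mpr fun m hm ↦ ?_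
      obtain ⟨p, rfl⟩ := Submodule.Quotient.mk_surjective _ m
      rw [← Submodule.Quotient.mk_smul, Submodule.Quotient.mk_eq_zero] at hm
      exact (Submodule.Quotient.mk_eq_zero _).mpr
        (mul_X_mem_span_X_image (by simpa using ha) hm)
    · intro m
      obtain ⟨p, rfl⟩ := Submodule.Quotient.mk_surjective _ m
      refine (Submodule.Quotient.mk_eq_zero _).trans ?_
      rw [Finset.coe_insert, Set.image_insert_eq, Ideal.mem_span_insert]
      constructor
      · rintro ⟨q, z, hz, rfl⟩
        refine ⟨Submodule.Quotient.mk q, ?_⟩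
        rw [← Submodule.Quotient.mk_smul]
        refine (Submodule.Quotient.eq _).mpr ?_
        rw [← neg_mem_iff]
        simpa [mul_comm] using hz
      · rintro ⟨m', hm'⟩
        obtain ⟨q, rfl⟩ := Submodule.Quotient.mk_surjective _ m'
        rw [← Submodule.Quotient.mk_smul] at hm'
        exact ⟨q, p - X a * q, (Submodule.Quotient.eq _).mp hm'.symm, by
          rw [mul_comm q, add_sub_cancel]; rfl⟩

end MvPolynomial

/-- A maximal independent set is dominating, so the infimum defining `indDomNum` is attained. -/
lemma exists_indDomNum_eq {V : Type} [Finite V] (G : SimpleGraph V) :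
    ∃ A : Set V, IsDominatingSet G A ∧ IsIndepSet G A ∧ A.ncard = indDomNum G := by
  refine Nat.sInf_mem (s := {n | ∃ A : Set V, IsDominatingSet G A ∧ IsIndepSet G A ∧
    A.ncard = n}) ?_
  obtain ⟨A, hA⟩ := (Set.toFinite {A : Set V | IsIndepSet G A}).exists_maximal
    ⟨∅, fun u hu ↦ hu.elim⟩
  refine ⟨_, A, fun v hv ↦ ?_, hA.prop, rfl⟩
  by_contra! hadj
  refine hv (hA.le_of_ge (y := insert v A) ?_ (Set.subset_insert v A) (Set.mem_insert v A))
  rintro x (rfl | hx) y (rfl | hy) h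
  · exact G.loopless.irrefl _ h
  · exact hadj y hy h
  · exact hadj x hx h.symm
  · exact hA.prop x hx y hy h

/-- The squarefree monomial supported on a dominating set moves the ideal of the complementary
variables into the edge ideal. -/
lemma prod_X_mul_mem_edgeIdeal (K : Type) [Field K] {V : Type} (G : SimpleGraph V)
    {A : Finset V} (hA : IsDominatingSet G A) {p : MvPolynomial V K}
    (hp : p ∈ Ideal.span (MvPolynomial.X '' (A : Set V)ᶜ : Set (MvPolynomial V K))) :
    (∏ a ∈ A, MvPolynomial.X a) * p ∈ edgeIdeal K G := by
  induction hp using Submodule.span_induction with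
  | mem x hx =>
    obtain ⟨v, hv, rfl⟩ := hx
    obtain ⟨a, ha, hadj⟩ := hA v hv
    refine Ideal.mem_of_dvd _ (mul_dvd_mul (Finset.dvd_prod_of_mem MvPolynomial.X ha) dvd_rfl) ?_
    exact Ideal.subset_span ⟨a, v, hadj.symm, rfl⟩
  | zero => simp
  | add x y _ _ hx hy => rw [mul_add]; exact add_mem hx hy
  | smul c x _ hx => rw [smul_eq_mul, mul_left_comm]; exact Ideal.mul_mem_left _ c hx

/-- The edge ideal lies in the ideal of variables outside an independent set. -/
lemma edgeIdeal_le_span_X_compl (K : Type) [Field K] {V : Type} (G : SimpleGraph V)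
    {A : Set V} (hA : IsIndepSet G A) :
    edgeIdeal K G ≤ Ideal.span (MvPolynomial.X '' Aᶜ) := by
  refine Ideal.span_le.mpr ?_
  rintro _ ⟨u, v, hadj, rfl⟩
  by_cases hu : u ∈ A
  · have hv : v ∉ A := fun hv ↦ hA u hu v hv hadj
    exact Ideal.mul_mem_left _ _ (Ideal.subset_span ⟨v, hv, rfl⟩)
  · exact Ideal.mul_mem_right _ _ (Ideal.subset_span ⟨u, hu, rfl⟩)

/-- The complement of an independent dominating set generates a minimal prime of the edge ideal,
whose height bounds the projective dimension from below. -/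
lemma card_compl_le_graphPd (K : Type) [Field K] {V : Type} [Fintype V] [DecidableEq V]
    (G : SimpleGraph V) {A : Finset V} (hdom : IsDominatingSet G A) (hind : IsIndepSet G A) :
    ((Aᶜ.card : ℕ) : ℕ∞) ≤ graphPd K G := by
  let ev : MvPolynomial V K →+* K := MvPolynomial.eval fun v ↦ if v ∈ A then 1 else 0
  let N : ModuleCat.{0} (MvPolynomial V K) :=
    (ModuleCat.restrictScalars ev).obj (ModuleCat.of K K)
  have hsmul (p : MvPolynomial V K) (y : N) : p • y = (show K from ev p * (show K from y)) := rfl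
  have : Nontrivial N := inferInstanceAs (Nontrivial K)
  have hkos := MvPolynomial.nontrivial_ext_quotient_span_X N Aᶜ fun v hv y ↦ by
    rw [hsmul]
    have h0 : ev (MvPolynomial.X v) = 0 := by simpa [ev] using hv
    rw [h0]
    exact zero_mul (M₀ := K) y
  rcases h : Aᶜ.card with _ | n
  · simp
  rw [h] at hkos
  rw [Finset.coe_compl] at hkos
  have hle := edgeIdeal_le_span_X_compl K G hind
  have hext : Nontrivial (Abelian.Ext (ModuleCat.of (MvPolynomial V K)
      (MvPolynomial V K ⧸ edgeIdeal K G)) N (n + 1)) := by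
    refine Abelian.Ext.nontrivial_of_surjective (r := ∏ a ∈ A, MvPolynomial.X a)
      (ModuleCat.ofHom (Submodule.factor hle)) (Submodule.factor_surjective hle) ?_ ?_ hkos
    · intro m hm
      obtain ⟨p, rfl⟩ := Submodule.Quotient.mk_surjective _ m
      rw [← Submodule.Quotient.mk_smul]
      exact (Submodule.Quotient.mk_eq_zero _).mpr
        (prod_X_mul_mem_edgeIdeal K G hdom ((Submodule.Quotient.mk_eq_zero _).mp hm))
    · intro y
      rw [hsmul]
      have h1 : ev (∏ a ∈ A, MvPolynomial.X a) = 1 := by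
        rw [map_prod]
        exact Finset.prod_eq_one fun a ha ↦ by simp [ev, ha]
      rw [h1]
      exact one_mul (M := K) y
  exact le_sSup ⟨n + 1, N, rfl, nontrivial_Ext_of_nontrivial_abelianExt hext⟩

/-- pd(G) ≥ n - i(G), stated as n ≤ pd(G) + i(G). -/
theorem stmt12 (K : Type) [Field K] {V : Type} [Fintype V] (G : SimpleGraph V) :
    (Fintype.card V : ℕ∞) ≤ graphPd K G + (indDomNum G : ℕ∞) := by
  classical
  obtain ⟨A, hdom, hind, hcard⟩ := exists_indDomNum_eq G
  obtain ⟨A, rfl⟩ := A.toFinite.exists_finset_coe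
  rw [← hcard, Set.ncard_coe_finset, ← A.card_compl_add_card, Nat.cast_add]
  gcongr
  exact card_compl_le_graphPd K G hdom hind
end

section
/- Let 𝒞 be a hereditary class of finite simple graphs such that every G ∈ 𝒞 having at least one edge contains a vertex v with γ(G) ≤ γ(G − v). Then every G ∈ 𝒞 on n vertices satisfies pd(G) ≤ n − γ(G). -/
open CategoryTheory
open scoped ENNReal

section Homological

open CategoryTheory.Limits

lemma isZero_Ext_of_hasProjectiveDimensionLT {R : Type} [CommRing R] (M N : ModuleCat.{0} R)
    (n i : ℕ) (h : HasProjectiveDimensionLT M (n + 1)) (hi : n < i) :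
    IsZero (((Ext R (ModuleCat R) i).obj (Opposite.op M)).obj N) := by
  obtain ⟨j, rfl⟩ : ∃ j, i = j + 1 := ⟨i - 1, by omega⟩
  let P := projectiveResolution M
  refine IsZero.of_iso ?_ (P.isoExt (j + 1) N)
  rw [← HomologicalComplex.exactAt_iff_isZero_homology,
    HomologicalComplex.exactAt_iff' _ j (j + 1) (j + 1 + 1) (by simp) (by simp),
    ShortComplex.moduleCat_exact_iff]
  intro (f : P.complex.X (j + 1) ⟶ N) hf
  have hf' : P.complex.d (j + 1 + 1) (j + 1) ≫ f = 0 := hf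
  exact (P.extMk_eq_zero_iff f (j + 1 + 1) rfl hf' j rfl).1
    (Abelian.Ext.eq_zero_of_hasProjectiveDimensionLT _ (n + 1) hi)

lemma projDim_le_of_hasProjectiveDimensionLT {R : Type} [CommRing R] (M : ModuleCat.{0} R) (n : ℕ)
    (h : HasProjectiveDimensionLT M (n + 1)) : projDim R M ≤ n := by
  refine sSup_le ?_
  rintro _ ⟨i, N, rfl, hN⟩
  by_contra! hlt
  have := isZero_Ext_of_hasProjectiveDimensionLT M N n i h (by exact_mod_cast hlt)
  exact not_subsingleton _ (ModuleCat.subsingleton_of_isZero this)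

variable {R : Type} [CommRing R] {I J L : Ideal R} {x : R}

/-- The complex `R ⧸ (I : x) → R ⧸ I → R ⧸ (I + (x))`, whose first map is multiplication
by `x`. -/
noncomputable abbrev colonShortComplex (hJ : ∀ a, a ∈ J ↔ x * a ∈ I)
    (hL : L = I ⊔ Ideal.span {x}) : ShortComplex (ModuleCat.{0} R) :=
  ModuleCat.shortComplexOfCompEqZero
    (Submodule.mapQ J I (LinearMap.mulLeft R x) (SetLike.le_def.2 fun {a} ha ↦ (hJ a).1 ha))
    (Submodule.mapQ I L LinearMap.id (SetLike.le_def.2 fun {_} ha ↦ hL ▸ Ideal.mem_sup_left ha)) <| by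
      refine LinearMap.ext fun y ↦ ?_
      obtain ⟨a, rfl⟩ := Submodule.Quotient.mk_surjective _ y
      have hx : x * a ∈ L := by
        rw [hL]
        exact Ideal.mem_sup_right (Ideal.mul_mem_right _ _ (Ideal.mem_span_singleton_self x))
      exact (Submodule.Quotient.mk_eq_zero L).2 hx

lemma colonShortComplex_shortExact (hJ : ∀ a, a ∈ J ↔ x * a ∈ I)
    (hL : L = I ⊔ Ideal.span {x}) : (colonShortComplex hJ hL).ShortExact := by
  refine ModuleCat.shortComplex_shortExact _ (LinearMap.exact_iff.2 ?_) ?_ ?_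
  · ext y
    obtain ⟨a, rfl⟩ := Submodule.Quotient.mk_surjective _ y
    simp only [ModuleCat.hom_ofHom, LinearMap.mem_ker, Submodule.mapQ_apply,
      LinearMap.id_apply, LinearMap.mem_range, Submodule.Quotient.mk_eq_zero]
    constructor
    · intro ha
      rw [hL] at ha
      obtain ⟨i, hi, j, hj, rfl⟩ := Submodule.mem_sup.1 ha
      obtain ⟨b, rfl⟩ := Ideal.mem_span_singleton'.1 hj
      refine ⟨Submodule.Quotient.mk b, ?_⟩
      rw [Submodule.mapQ_apply, Submodule.Quotient.eq]
      have : LinearMap.mulLeft R x b - (i + b * x) = -i := by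
        simp only [LinearMap.mulLeft_apply]; ring
      rw [this]
      exact I.neg_mem hi
    · rintro ⟨y, hy⟩
      obtain ⟨b, rfl⟩ := Submodule.Quotient.mk_surjective _ y
      rw [Submodule.mapQ_apply, Submodule.Quotient.eq, LinearMap.mulLeft_apply] at hy
      have : a = x * b - (x * b - a) := by ring
      rw [hL, this]
      exact Ideal.sub_mem _ (Ideal.mem_sup_right
        (Ideal.mul_mem_right _ _ (Ideal.mem_span_singleton_self x))) (Ideal.mem_sup_left hy)
  · refine (injective_iff_map_eq_zero (ModuleCat.Hom.hom (colonShortComplex hJ hL).f)).2 ?_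
    intro y hy
    obtain ⟨a, rfl⟩ := Submodule.Quotient.mk_surjective _ y
    simp only [ModuleCat.hom_ofHom, Submodule.mapQ_apply,
      Submodule.Quotient.mk_eq_zero] at hy
    exact (Submodule.Quotient.mk_eq_zero J).2 ((hJ a).2 hy)
  · intro y
    obtain ⟨a, rfl⟩ := Submodule.Quotient.mk_surjective _ y
    exact ⟨Submodule.Quotient.mk a, rfl⟩

end Homological

section MonomialIdeal

open MvPolynomial

variable (K : Type) [Field K] {V : Type} (G : SimpleGraph V)

/-- The ideal generated by the edge ideal of the subgraph of `G` induced on `W`, together with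
the variables in `T`. -/
noncomputable def edgeVarIdeal (W T : Finset V) : Ideal (MvPolynomial V K) :=
  Ideal.span {m | ∃ u ∈ W, ∃ v ∈ W, G.Adj u v ∧ m = X u * X v} ⊔ Ideal.span (X '' (T : Set V))

variable {K G}

lemma mem_edgeVarIdeal {W T : Finset V} {p : MvPolynomial V K} :
    p ∈ edgeVarIdeal K G W T ↔ ∀ m ∈ p.support,
      (∃ u ∈ W, ∃ v ∈ W, G.Adj u v ∧ m u ≠ 0 ∧ m v ≠ 0) ∨ ∃ t ∈ T, m t ≠ 0 := by
  have key : edgeVarIdeal K G W T = Ideal.span ((fun s ↦ monomial s (1 : K)) ''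
      ({s | ∃ u ∈ W, ∃ v ∈ W, G.Adj u v ∧ s = Finsupp.single u 1 + Finsupp.single v 1} ∪
        {s | ∃ t ∈ T, s = Finsupp.single t 1})) := by
    rw [edgeVarIdeal, ← Ideal.span_union]
    congr 1
    ext q
    simp only [X, monomial_mul, one_mul, Set.mem_union, Set.mem_ofPred_eq, Set.mem_image,
      SetLike.mem_coe]
    constructor
    · rintro (⟨u, hu, v, hv, h, rfl⟩ | ⟨t, ht, rfl⟩)
      · exact ⟨_, .inl ⟨u, hu, v, hv, h, rfl⟩, rfl⟩
      · exact ⟨_, .inr ⟨t, ht, rfl⟩, rfl⟩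
    · rintro ⟨_, ⟨u, hu, v, hv, h, rfl⟩ | ⟨t, ht, rfl⟩, rfl⟩
      · exact .inl ⟨u, hu, v, hv, h, rfl⟩
      · exact .inr ⟨t, ht, rfl⟩
  rw [key, mem_ideal_span_monomial_image]
  refine forall₂_congr fun m _ ↦ ⟨?_, ?_⟩
  · rintro ⟨_, ⟨u, hu, v, hv, h, rfl⟩ | ⟨t, ht, rfl⟩, hle⟩
    · refine .inl ⟨u, hu, v, hv, h, ?_, ?_⟩
      · have := hle u
        simp only [Finsupp.add_apply, Finsupp.single_eq_same] at this
        omega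
      · have := hle v
        simp only [Finsupp.add_apply, Finsupp.single_eq_same] at this
        omega
    · have := hle t
      simp only [Finsupp.single_eq_same] at this
      exact .inr ⟨t, ht, by omega⟩
  · classical
    rintro (⟨u, hu, v, hv, h, hmu, hmv⟩ | ⟨t, ht, hmt⟩)
    · refine ⟨_, .inl ⟨u, hu, v, hv, h, rfl⟩, fun w ↦ ?_⟩
      have := h.ne
      simp only [Finsupp.add_apply, Finsupp.single_apply]
      split_ifs <;> subst_vars <;> first | omega | exact absurd rfl this
    · refine ⟨_, .inr ⟨t, ht, rfl⟩, fun w ↦ ?_⟩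
      simp only [Finsupp.single_apply]
      split_ifs <;> subst_vars <;> omega

lemma X_mul_mem_edgeVarIdeal {W T : Finset V} {p : MvPolynomial V K} {x : V} :
    X x * p ∈ edgeVarIdeal K G W T ↔ ∀ m ∈ p.support,
      (∃ u ∈ W, ∃ v ∈ W, G.Adj u v ∧ (x = u ∨ m u ≠ 0) ∧ (x = v ∨ m v ≠ 0)) ∨
        ∃ t ∈ T, x = t ∨ m t ≠ 0 := by
  classical
  have (m : V →₀ ℕ) (u : V) : (Finsupp.single x 1 + m : V →₀ ℕ) u ≠ 0 ↔ x = u ∨ m u ≠ 0 := by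
    simp only [Finsupp.add_apply, Finsupp.single_apply]
    split_ifs <;> simp_all
  simp only [mem_edgeVarIdeal, support_X_mul, Finset.mem_map, addLeftEmbedding_apply,
    forall_exists_index, and_imp, forall_apply_eq_imp_iff₂, this]

variable [DecidableEq V] {W T : Finset V} {v : V}

lemma edgeVarIdeal_sup_span_X :
    edgeVarIdeal K G W T ⊔ Ideal.span {X v} = edgeVarIdeal K G W (insert v T) := by
  rw [edgeVarIdeal, edgeVarIdeal, Finset.coe_insert, Set.image_insert_eq, Ideal.span_insert,
    sup_assoc, sup_comm (Ideal.span {X v})]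

lemma edgeVarIdeal_erase :
    edgeVarIdeal K G (W.erase v) (insert v T) = edgeVarIdeal K G W (insert v T) := by
  ext p
  simp only [mem_edgeVarIdeal]
  refine forall₂_congr fun m _ ↦ ⟨?_, ?_⟩
  · rintro (⟨a, ha, b, hb, h⟩ | h)
    · exact .inl ⟨a, Finset.mem_of_mem_erase ha, b, Finset.mem_of_mem_erase hb, h⟩
    · exact .inr h
  · rintro (⟨a, ha, b, hb, hab, hma, hmb⟩ | h)
    · by_cases hav : a = v
      · exact .inr ⟨v, by simp, hav ▸ hma⟩
      by_cases hbv : b = v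
      · exact .inr ⟨v, by simp, hbv ▸ hmb⟩
      exact .inl ⟨a, by simp [*], b, by simp [*], hab, hma, hmb⟩
    · exact .inr h

lemma mem_edgeVarIdeal_iff_X_mul_mem [DecidableRel G.Adj] (hv : v ∈ W) (hvT : v ∉ T)
    (p : MvPolynomial V K) :
    p ∈ edgeVarIdeal K G {w ∈ W.erase v | ¬ G.Adj v w} (T ∪ {w ∈ W | G.Adj v w}) ↔
      X v * p ∈ edgeVarIdeal K G W T := by
  rw [mem_edgeVarIdeal, X_mul_mem_edgeVarIdeal]
  refine forall₂_congr fun m _ ↦ ⟨?_, ?_⟩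
  · rintro (⟨a, ha, b, hb, hab, hma, hmb⟩ | ⟨t, ht, hmt⟩)
    · simp only [Finset.mem_filter, Finset.mem_erase] at ha hb
      exact .inl ⟨a, ha.1.2, b, hb.1.2, hab, .inr hma, .inr hmb⟩
    · rcases Finset.mem_union.1 ht with ht | ht
      · exact .inr ⟨t, ht, .inr hmt⟩
      · rw [Finset.mem_filter] at ht
        exact .inl ⟨v, hv, t, ht.1, ht.2, .inl rfl, .inr hmt⟩
  · rintro (⟨a, ha, b, hb, hab, hma, hmb⟩ | ⟨t, ht, rfl | hmt⟩)
    · by_cases hva : v = a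
      · subst hva
        exact .inr ⟨b, by simp [*], hmb.resolve_left hab.ne⟩
      by_cases hvb : v = b
      · subst hvb
        exact .inr ⟨a, by simp [*, hab.symm], hma.resolve_left hva⟩
      replace hma := hma.resolve_left hva
      replace hmb := hmb.resolve_left hvb
      by_cases hva' : G.Adj v a
      · exact .inr ⟨a, by simp [*], hma⟩
      by_cases hvb' : G.Adj v b
      · exact .inr ⟨b, by simp [*], hmb⟩
      exact .inl ⟨a, by simp [*, Ne.symm hva], b, by simp [*, Ne.symm hvb], hab, hma, hmb⟩
    · exact absurd ht hvT
    · exact .inr ⟨t, by simp [ht], hmt⟩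

variable (K) in
lemma hasProjectiveDimensionLT_quotient_edgeVarIdeal_of_indep
    (hW : ∀ u ∈ W, ∀ w ∈ W, ¬ G.Adj u w) :
    HasProjectiveDimensionLT
      (ModuleCat.of (MvPolynomial V K) (MvPolynomial V K ⧸ edgeVarIdeal K G W T))
      (T.card + 1) := by
  induction T using Finset.induction_on with
  | empty =>
    have h0 : edgeVarIdeal K G W ∅ = ⊥ := by
      refine (Submodule.eq_bot_iff _).2 fun p hp ↦ ?_
      rw [mem_edgeVarIdeal] at hp
      refine support_eq_empty.1 (Finset.eq_empty_of_forall_notMem fun m hm ↦ ?_)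
      rcases hp m hm with ⟨a, ha, b, hb, hab, -⟩ | ⟨t, ht, -⟩
      · exact hW a ha b hb hab
      · simp at ht
    have : Projective (ModuleCat.of (MvPolynomial V K) (MvPolynomial V K)) :=
      (IsProjective.iff_projective _).1 inferInstance
    exact hasProjectiveDimensionLT_of_iso
      (Submodule.quotEquivOfEqBot _ h0).symm.toModuleIso 1
  | insert t T ht ih =>
    have hJ (p) : p ∈ edgeVarIdeal K G W T ↔ X t * p ∈ edgeVarIdeal K G W T := by
      rw [mem_edgeVarIdeal, X_mul_mem_edgeVarIdeal]
      refine forall₂_congr fun m _ ↦ or_congr ⟨?_, ?_⟩ ⟨?_, ?_⟩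
      · rintro ⟨a, ha, b, hb, hab, -⟩
        exact (hW a ha b hb hab).elim
      · rintro ⟨a, ha, b, hb, hab, -⟩
        exact (hW a ha b hb hab).elim
      · rintro ⟨s, hs, h⟩
        exact ⟨s, hs, .inr h⟩
      · rintro ⟨s, hs, rfl | h⟩
        · exact absurd hs ht
        · exact ⟨s, hs, h⟩
    rw [Finset.card_insert_of_notMem ht]
    exact (colonShortComplex_shortExact hJ
      edgeVarIdeal_sup_span_X.symm).hasProjectiveDimensionLT_X₃ (T.card + 1) ih
        (hasProjectiveDimensionLT_of_ge _ (T.card + 1) _ (Nat.le_succ _))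

variable (K) in
lemma hasProjectiveDimensionLT_quotient_edgeVarIdeal [DecidableRel G.Adj]
    (P : Finset V → Prop) (g : Finset V → ℕ) (hP : ∀ W W', W' ⊆ W → P W → P W')
    (hcard : ∀ W, g W ≤ W.card)
    (hnbhd : ∀ W, ∀ v ∈ W, g W ≤ g {w ∈ W.erase v | ¬ G.Adj v w} + 1)
    (herase : ∀ W, P W → (∃ u ∈ W, ∃ w ∈ W, G.Adj u w) → ∃ v ∈ W, g W ≤ g (W.erase v))
    (n : ℕ) (W T : Finset V) (hW : P W) (hWT : Disjoint W T)
    (hn : W.card + T.card ≤ n + g W) :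
    HasProjectiveDimensionLT
      (ModuleCat.of (MvPolynomial V K) (MvPolynomial V K ⧸ edgeVarIdeal K G W T)) (n + 1) := by
  induction W using Finset.strongInduction generalizing T with
  | H W ih =>
  by_cases hedge : ∃ u ∈ W, ∃ w ∈ W, G.Adj u w
  · obtain ⟨v, hv, hgv⟩ := herase W hW hedge
    have hvT : v ∉ T := Finset.disjoint_left.1 hWT hv
    have hlt : W.erase v ⊂ W := Finset.erase_ssubset hv
    have hlt' : {w ∈ W.erase v | ¬ G.Adj v w} ⊂ W :=
      (Finset.filter_subset _ _).trans_ssubset hlt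
    have hNT : Disjoint T {w ∈ W | G.Adj v w} :=
      hWT.symm.mono_right (Finset.filter_subset _ _)
    have hcv := Finset.card_erase_add_one hv
    have hN : {w ∈ W.erase v | G.Adj v w} = {w ∈ W | G.Adj v w} := by
      ext w
      simp only [Finset.mem_filter, Finset.mem_erase]
      exact ⟨fun h ↦ ⟨h.1.2, h.2⟩, fun h ↦ ⟨⟨h.2.ne', h.1⟩, h.2⟩⟩
    have hsplit := Finset.card_filter_add_card_filter_not (s := W.erase v) (G.Adj v)
    rw [hN] at hsplit
    have hgN := hnbhd W v hv
    refine (colonShortComplex_shortExact (mem_edgeVarIdeal_iff_X_mul_mem hv hvT)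
      (edgeVarIdeal_erase.trans edgeVarIdeal_sup_span_X.symm)).hasProjectiveDimensionLT_X₂
        (n + 1) (ih _ hlt' _ (hP _ _ hlt'.1 hW) ?_ ?_) (ih _ hlt _ (hP _ _ hlt.1 hW) ?_ ?_)
    · refine Finset.disjoint_union_right.2 ⟨hWT.mono_left hlt'.1, ?_⟩
      refine Finset.disjoint_left.2 fun w hw hw' ↦ ?_
      exact (Finset.mem_filter.1 hw).2 (Finset.mem_filter.1 hw').2
    · rw [Finset.card_union_of_disjoint hNT]
      omega
    · exact Finset.disjoint_insert_right.2 ⟨Finset.notMem_erase v W, hWT.mono_left hlt.1⟩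
    · rw [Finset.card_insert_of_notMem hvT]
      omega
  · push Not at hedge
    have := hasProjectiveDimensionLT_quotient_edgeVarIdeal_of_indep K (T := T) hedge
    have := hcard W
    exact hasProjectiveDimensionLT_of_ge _ (T.card + 1) (n + 1) (by omega)

end MonomialIdeal

section Domination

variable {V : Type}

lemma domNum_le [Finite V] {G : SimpleGraph V} {A : Set V} (hA : IsDominatingSet G A) :
    domNum G ≤ A.ncard :=
  Nat.sInf_le ⟨A, hA, rfl⟩

lemma exists_isDominatingSet_ncard_eq_domNum (G : SimpleGraph V) :
    ∃ A, IsDominatingSet G A ∧ A.ncard = domNum G :=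
  Nat.sInf_mem (s := {n | ∃ A : Set V, IsDominatingSet G A ∧ A.ncard = n})
    ⟨_, Set.univ, fun v hv ↦ absurd (Set.mem_univ v) hv, rfl⟩

lemma domNum_le_card [Finite V] (G : SimpleGraph V) : domNum G ≤ Nat.card V :=
  Set.ncard_univ V ▸ domNum_le fun v hv ↦ absurd (Set.mem_univ v) hv

lemma domNum_le_of_iso {V' : Type} [Finite V'] {G : SimpleGraph V} {G' : SimpleGraph V'}
    (e : G ≃g G') : domNum G' ≤ domNum G := by
  obtain ⟨A, hA, hcard⟩ := exists_isDominatingSet_ncard_eq_domNum G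
  rw [← hcard, ← Set.ncard_image_of_injective A e.injective]
  refine domNum_le fun w hw ↦ ?_
  obtain ⟨v, rfl⟩ := e.surjective w
  obtain ⟨a, ha, hva⟩ := hA v fun hv ↦ hw ⟨v, hv, rfl⟩
  exact ⟨e a, ⟨a, ha, rfl⟩, e.map_adj_iff.2 hva⟩

lemma domNum_induce_le_add_one [Finite V] [DecidableEq V] (G : SimpleGraph V)
    [DecidableRel G.Adj] {W : Finset V} {v : V} (hv : v ∈ W) :
    domNum (G.induce (W : Set V)) ≤
      domNum (G.induce (({w ∈ W.erase v | ¬ G.Adj v w} : Finset V) : Set V)) + 1 := by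
  obtain ⟨A, hA, hcard⟩ := exists_isDominatingSet_ncard_eq_domNum
    (G.induce (({w ∈ W.erase v | ¬ G.Adj v w} : Finset V) : Set V))
  have hsub : (({w ∈ W.erase v | ¬ G.Adj v w} : Finset V) : Set V) ⊆ W := fun w hw ↦
    Finset.mem_of_mem_erase (Finset.mem_filter.1 hw).1
  rw [← hcard, ← Set.ncard_image_of_injective A (Set.inclusion_injective hsub)]
  refine (domNum_le fun w hw ↦ ?_).trans (Set.ncard_insert_le ⟨v, hv⟩ _)
  by_cases hvw : G.Adj v w
  · exact ⟨_, Set.mem_insert _ _, hvw.symm⟩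
  have hwv : (w : V) ≠ v := fun h ↦ hw (.inl (Subtype.ext h))
  have hmem : (w : V) ∈ (({w ∈ W.erase v | ¬ G.Adj v w} : Finset V) : Set V) :=
    Finset.mem_filter.2 ⟨Finset.mem_erase.2 ⟨hwv, w.2⟩, hvw⟩
  obtain ⟨a, ha, hwa⟩ := hA ⟨w, hmem⟩ fun h ↦ hw (.inr ⟨_, h, rfl⟩)
  exact ⟨_, .inr ⟨a, ha, rfl⟩, hwa⟩

end Domination

/-- Deleting a vertex from a graph isomorphic to `G.induce W` gives a graph isomorphic to
the graph induced on `W` without the corresponding vertex. -/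
def induceComplSingletonIso {V V' : Type} [DecidableEq V] {G : SimpleGraph V}
    {G' : SimpleGraph V'} {W : Finset V} (e : G' ≃g G.induce (W : Set V)) (v : V') :
    G'.induce ({v}ᶜ : Set V') ≃g G.induce ((W.erase (e v : V) : Finset V) : Set V) where
  toFun x := ⟨e x, Finset.mem_erase.2
    ⟨fun h ↦ x.2 (e.injective (Subtype.ext h)), (e x).2⟩⟩
  invFun y := ⟨e.symm ⟨y, Finset.mem_of_mem_erase y.2⟩, fun h ↦
    Finset.ne_of_mem_erase y.2 <| by
      simpa using congrArg (fun z ↦ (e z : V)) (Set.mem_singleton_iff.1 h)⟩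
  left_inv x := by simp
  right_inv y := by simp
  map_rel_iff' {a b} := e.map_adj_iff (v := a) (w := b)

/-- pd(G) ≤ n - γ(G), stated as pd(G) + γ(G) ≤ n. -/
theorem stmt14 (K : Type) [Field K]
    (C : ∀ (V : Type) [Finite V], SimpleGraph V → Prop)
    (hered : ∀ (V : Type) [Finite V] (G : SimpleGraph V), C V G →
      ∀ v : V, C ({v}ᶜ : Set V) (G.induce {v}ᶜ))
    (hcond : ∀ (V : Type) [Finite V] (G : SimpleGraph V), C V G → (∃ u v : V, G.Adj u v) →
      ∃ v : V, domNum G ≤ domNum (G.induce ({v}ᶜ : Set V))) :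
    ∀ (V : Type) [Finite V] (G : SimpleGraph V), C V G →
      graphPd K G + (domNum G : ℕ∞) ≤ (Nat.card V : ℕ∞) := by
  intro V _ G hG
  classical
  have := Fintype.ofFinite V
  let P (W : Finset V) : Prop := ∃ (V' : Type) (_ : Finite V') (G' : SimpleGraph V'),
    C V' G' ∧ Nonempty (G' ≃g G.induce (W : Set V))
  have hPerase (W : Finset V) (v : V) (hW : P W) : P (W.erase v) := by
    by_cases hv : v ∈ W
    · obtain ⟨V', _, G', hG', ⟨e⟩⟩ := hW
      obtain ⟨v', hv'⟩ := e.surjective ⟨v, hv⟩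
      have e' := induceComplSingletonIso e v'
      rw [hv'] at e'
      exact ⟨_, inferInstance, _, hered V' G' hG' v', ⟨e'⟩⟩
    · rwa [Finset.erase_eq_of_notMem hv]
  have hPsub (W W' : Finset V) (h : W' ⊆ W) (hW : P W) : P W' := by
    have hsdiff (T : Finset V) : P (W \ T) := by
      induction T using Finset.induction_on with
      | empty => simpa using hW
      | insert t T _ ih =>
        rw [Finset.sdiff_insert]
        exact hPerase _ _ ih
    simpa [Finset.sdiff_sdiff_eq_self h] using hsdiff (W \ W')
  have hPuniv : P Finset.univ := by
    refine ⟨V, inferInstance, G, hG, ⟨?_⟩⟩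
    rw [Finset.coe_univ]
    exact (SimpleGraph.induceUnivIso G).symm
  have hdom : domNum G ≤ domNum (G.induce ((Finset.univ : Finset V) : Set V)) := by
    refine domNum_le_of_iso ?_
    rw [Finset.coe_univ]
    exact SimpleGraph.induceUnivIso G
  have hdomcard := domNum_le_card G
  have hideal : edgeVarIdeal K G Finset.univ ∅ = edgeIdeal K G := by
    simp [edgeVarIdeal, edgeIdeal]
  have hpd := hasProjectiveDimensionLT_quotient_edgeVarIdeal (G := G) K P
    (fun W ↦ domNum (G.induce (W : Set V))) hPsub
    (fun W ↦ (domNum_le_card _).trans_eq (by simp))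
    (fun W v hv ↦ domNum_induce_le_add_one G hv)
    (by
      rintro W ⟨V', _, G', hG', ⟨e⟩⟩ ⟨u, hu, w, hw, huw⟩
      obtain ⟨v, hv⟩ := hcond V' G' hG'
        ⟨e.symm ⟨u, hu⟩, e.symm ⟨w, hw⟩, e.symm.map_adj_iff.2 huw⟩
      exact ⟨e v, (e v).2, (domNum_le_of_iso e).trans
        (hv.trans (domNum_le_of_iso (induceComplSingletonIso e v).symm))⟩)
    (Nat.card V - domNum G) Finset.univ ∅ hPuniv (Finset.disjoint_empty_right _)
    (by simp only [Finset.card_univ, Finset.card_empty, ← Nat.card_eq_fintype_card]; omega)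
  rw [hideal] at hpd
  calc graphPd K G + (domNum G : ℕ∞)
      ≤ ((Nat.card V - domNum G : ℕ) : ℕ∞) + domNum G := by
        gcongr
        exact projDim_le_of_hasProjectiveDimensionLT _ _ hpd
    _ = Nat.card V := by rw [← Nat.cast_add, Nat.sub_add_cancel hdomcard]
end
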